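/- arXiv:2303.16237 — 6 statements merged into one kernel-verified Lean document; each statement's English description precedes it below -/
import Mathlib

section
/- Let T : ℤ → Fin 4 be a nonrepetitive and palindrome-free sequence. If v₁, …, v_k, v_{k+1}, …, v_{2k} (k ≥ 1) is a lazy walk in ℤ (i.e. |v_{i+1} − v_i| ≤ 1 for all 1 ≤ i < 2k) that is repetitive with respect to T (i.e. T(v_i) = T(v_{k+i}) for all 1 ≤ i ≤ k), then v_i = v_{k+i} for all 1 ≤ i ≤ k; that is, the lazy walk is composed of two identical lazy walks. -/
/-- A sequence `T : ℤ → S` is nonrepetitive if there are no `i ∈ ℤ` and `k ≥ 1`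
such that `T (i+t) = T (i+k+t)` for all `0 ≤ t < k`. -/
def Nonrepetitive {S : Type*} (T : ℤ → S) : Prop :=
  ¬ ∃ (i : ℤ) (k : ℕ), 1 ≤ k ∧ ∀ t : ℕ, t < k → T (i + t) = T (i + k + t)

/-- A sequence `T : ℤ → S` is palindrome-free if there are no integers `i < j`
such that `T (i+t) = T (j-t)` for all `0 ≤ t ≤ j - i`. -/
def PalindromeFree {S : Type*} (T : ℤ → S) : Prop :=
  ¬ ∃ i j : ℤ, i < j ∧ ∀ t : ℤ, 0 ≤ t → t ≤ j - i → T (i + t) = T (j - t)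

theorem Nonrepetitive.not_forall_eq {S : Type*} {T : ℤ → S} (h : Nonrepetitive T) {p q c : ℤ}
    (hc : 0 < c) (hpq : p + c ≤ q + 1) : ¬ ∀ x, p ≤ x → x ≤ q → T x = T (x + c) := by
  intro hT
  refine h ⟨p, c.toNat, by omega, fun t ht => ?_⟩
  rw [hT (p + t) (by omega) (by omega)]
  congr 1
  omega

theorem PalindromeFree.not_forall_eq {S : Type*} {T : ℤ → S} (h : PalindromeFree T) {p q : ℤ}
    (hpq : p < q) : ¬ ∀ x, p ≤ x → x ≤ q → T x = T (p + q - x) := by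
  intro hT
  refine h ⟨p, q, hpq, fun t ht0 ht => ?_⟩
  rw [hT (p + t) (by omega) (by omega)]
  congr 1
  omega

/-- Terms at distance at most two in a palindrome-free sequence are distinct. -/
theorem eq_of_apply_eq_of_abs_sub_le_two {S : Type*} {T : ℤ → S} (hpf : PalindromeFree T)
    {x y : ℤ} (hT : T x = T y) (hxy : |x - y| ≤ 2) : x = y := by
  wlog hlt : x ≤ y generalizing x y
  · exact (this hT.symm (by rwa [abs_sub_comm]) (by omega)).symm
  rw [abs_le] at hxy
  by_contra hne
  refine hpf.not_forall_eq (p := x) (q := y) (by omega) fun z hz hz' => ?_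
  obtain rfl | rfl | h : z = x ∨ z = y ∨ z = x + y - z := by omega
  · rw [hT]; congr 1; omega
  · rw [← hT]; congr 1; omega
  · rw [← h]

theorem exists_le_eq_of_lazy {f : ℕ → ℤ} {n : ℕ} (hf : ∀ i < n, |f (i + 1) - f i| ≤ 1) {x : ℤ}
    (h0 : f 0 ≤ x) (hn : x ≤ f n) : ∃ i ≤ n, f i = x := by
  induction n with
  | zero => exact ⟨0, le_rfl, by omega⟩
  | succ n ih =>
    by_cases h : x ≤ f n
    · obtain ⟨i, hi, rfl⟩ := ih (fun i hi => hf i (by omega)) h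
      exact ⟨i, by omega, rfl⟩
    · have := abs_le.1 (hf n (by omega))
      exact ⟨n + 1, le_rfl, by omega⟩

theorem exists_le_eq_of_lazy_of_mem_uIcc {f : ℕ → ℤ} {n : ℕ}
    (hf : ∀ i < n, |f (i + 1) - f i| ≤ 1) {x : ℤ}
    (hx : f 0 ≤ x ∧ x ≤ f n ∨ f n ≤ x ∧ x ≤ f 0) : ∃ i ≤ n, f i = x := by
  obtain ⟨h0, hn⟩ | ⟨hn, h0⟩ := hx
  · exact exists_le_eq_of_lazy hf h0 hn
  · obtain ⟨i, hi, h⟩ := exists_le_eq_of_lazy (f := fun i => -f i) (n := n) (x := -x)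
      (fun i hi => by rw [abs_le]; have := abs_le.1 (hf i hi); constructor <;> omega)
      (by omega) (by omega)
    exact ⟨i, hi, by omega⟩

/-- Two lazy walks with the same labels that start at the same vertex coincide. -/
theorem lazy_walks_eq_of_start_eq {S : Type*} {T : ℤ → S} (hpf : PalindromeFree T)
    {a b : ℕ → ℤ} {n : ℕ} (ha : ∀ i < n, |a (i + 1) - a i| ≤ 1)
    (hb : ∀ i < n, |b (i + 1) - b i| ≤ 1) (hT : ∀ i ≤ n, T (a i) = T (b i)) (h0 : a 0 = b 0) :
    ∀ i ≤ n, a i = b i := by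
  intro i
  induction i with
  | zero => exact fun _ => h0
  | succ i ih =>
    intro hi
    have hi' := ih (by omega)
    have h1 := abs_le.1 (ha i (by omega))
    have h2 := abs_le.1 (hb i (by omega))
    exact eq_of_apply_eq_of_abs_sub_le_two hpf (hT _ hi) (by rw [abs_le]; omega)

/-- Two lazy walks with the same labels differ by a translation or by a reflection. -/
theorem lazy_walks_sub_const_or_add_const {S : Type*} {T : ℤ → S} (hpf : PalindromeFree T)
    {a b : ℕ → ℤ} {n : ℕ} (ha : ∀ i < n, |a (i + 1) - a i| ≤ 1)
    (hb : ∀ i < n, |b (i + 1) - b i| ≤ 1) (hT : ∀ i ≤ n, T (a i) = T (b i)) :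
    (∀ i ≤ n, b i - a i = b 0 - a 0) ∨ ∀ i ≤ n, b i + a i = b 0 + a 0 := by
  have inj {x y : ℤ} (h : T x = T y) (h1 : -2 ≤ x - y) (h2 : x - y ≤ 2) : x = y :=
    eq_of_apply_eq_of_abs_sub_le_two hpf h (abs_le.2 ⟨h1, h2⟩)
  -- The walks stay put, or some neighbouring pair of labels fixes the orientation.
  suffices H : (∀ i ≤ n, a i = a 0 ∧ b i = b 0) ∨
      (∀ i ≤ n, b i - a i = b 0 - a 0) ∧
        (T (a n + 1) = T (b n + 1) ∨ T (a n - 1) = T (b n - 1)) ∨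
      (∀ i ≤ n, b i + a i = b 0 + a 0) ∧
        (T (a n + 1) = T (b n - 1) ∨ T (a n - 1) = T (b n + 1)) by
    obtain H | ⟨H, -⟩ | ⟨H, -⟩ := H
    · exact .inl fun i hi => by rw [(H i hi).1, (H i hi).2]
    · exact .inl H
    · exact .inr H
  induction n with
  | zero =>
    left
    intro i hi
    obtain rfl : i = 0 := by omega
    exact ⟨rfl, rfl⟩
  | succ n ih =>
    have IH := ih (fun i hi => ha i (by omega)) (fun i hi => hb i (by omega))
      (fun i hi => hT i (by omega))
    have h1 := abs_le.1 (ha n (by omega))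
    have h2 := abs_le.1 (hb n (by omega))
    have t0 := hT n (by omega)
    have t1 := hT (n + 1) le_rfl
    have extend {P : ℕ → Prop} (h : ∀ i ≤ n, P i) (h' : P (n + 1)) : ∀ i ≤ n + 1, P i := by
      intro i hi
      obtain hi | rfl := Nat.le_succ_iff.1 hi
      exacts [h i hi, h']
    have hstay : a (n + 1) = a n ↔ b (n + 1) = b n := by
      constructor <;> intro h
      · exact inj (by rw [← t1, h, t0]) (by omega) (by omega)
      · exact inj (by rw [t1, h, t0]) (by omega) (by omega)
    have ha' : a (n + 1) = a n ∨ a (n + 1) = a n + 1 ∨ a (n + 1) = a n - 1 := by omega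
    have hb' : b (n + 1) = b n ∨ b (n + 1) = b n + 1 ∨ b (n + 1) = b n - 1 := by omega
    obtain H | ⟨H, N⟩ | ⟨H, N⟩ := IH
    · have Hn := H n le_rfl
      obtain h | h | h := ha' <;> obtain h' | h' | h' := hb' <;> try omega
      · exact .inl (extend H (by omega))
      · exact .inr (.inl ⟨extend (fun i hi => by rw [(H i hi).1, (H i hi).2]) (by omega),
          .inr (by simpa [h, h'] using t0)⟩)
      · exact .inr (.inr ⟨extend (fun i hi => by rw [(H i hi).1, (H i hi).2]) (by omega),
          .inr (by simpa [h, h'] using t0)⟩)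
      · exact .inr (.inr ⟨extend (fun i hi => by rw [(H i hi).1, (H i hi).2]) (by omega),
          .inl (by simpa [h, h'] using t0)⟩)
      · exact .inr (.inl ⟨extend (fun i hi => by rw [(H i hi).1, (H i hi).2]) (by omega),
          .inl (by simpa [h, h'] using t0)⟩)
    · have Hn := H n le_rfl
      refine .inr (.inl ?_)
      obtain h | h | h := ha' <;> obtain h' | h' | h' := hb' <;> try omega
      · exact ⟨extend H (by omega), by rwa [h, h']⟩
      · exact ⟨extend H (by omega), .inr (by simpa [h, h'] using t0)⟩
      · rw [h, h'] at t1
        obtain N | N := N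
        · have := inj (N.symm.trans t1) (by omega) (by omega); omega
        · have := inj (N.trans t1.symm) (by omega) (by omega); omega
      · rw [h, h'] at t1
        obtain N | N := N
        · have := inj (N.trans t1.symm) (by omega) (by omega); omega
        · have := inj (N.symm.trans t1) (by omega) (by omega); omega
      · exact ⟨extend H (by omega), .inl (by simpa [h, h'] using t0)⟩
    · have Hn := H n le_rfl
      refine .inr (.inr ?_)
      obtain h | h | h := ha' <;> obtain h' | h' | h' := hb' <;> try omega
      · exact ⟨extend H (by omega), by rwa [h, h']⟩
      · rw [h, h'] at t1
        obtain N | N := N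
        · have := inj (N.symm.trans t1) (by omega) (by omega); omega
        · have := inj (N.trans t1.symm) (by omega) (by omega); omega
      · exact ⟨extend H (by omega), .inr (by simpa [h, h'] using t0)⟩
      · exact ⟨extend H (by omega), .inl (by simpa [h, h'] using t0)⟩
      · rw [h, h'] at t1
        obtain N | N := N
        · have := inj (N.trans t1.symm) (by omega) (by omega); omega
        · have := inj (N.symm.trans t1) (by omega) (by omega); omega

/-- **Theorem 1.** Any repetitive lazy walk in a nonrepetitive, palindrome-free
sequence `T : ℤ → Fin 4` is composed of two identical lazy walks.
The walk is `v 0, v 1, …, v (2k-1)` (so `v i` here is `v_{i+1}` in the paper). -/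
theorem repetitive_lazy_walk_is_two_identical_walks
    (T : ℤ → Fin 4) (hnr : Nonrepetitive T) (hpf : PalindromeFree T)
    (k : ℕ) (hk : 1 ≤ k) (v : ℕ → ℤ)
    (hlazy : ∀ i : ℕ, i + 1 < 2 * k → |v (i + 1) - v i| ≤ 1)
    (hrep : ∀ i < k, T (v i) = T (v (k + i))) :
    ∀ i < k, v i = v (k + i) := by
  obtain ⟨n, rfl⟩ : ∃ n, k = n + 1 := ⟨k - 1, by omega⟩
  obtain ⟨b, hb⟩ : ∃ b : ℕ → ℤ, ∀ i, b i = v (n + 1 + i) := ⟨_, fun _ => rfl⟩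
  have la : ∀ i < n, |v (i + 1) - v i| ≤ 1 := fun i hi => hlazy i (by omega)
  have lb : ∀ i < n, |b (i + 1) - b i| ≤ 1 := fun i hi => by
    rw [hb, hb]; exact hlazy (n + 1 + i) (by omega)
  have hT : ∀ i ≤ n, T (v i) = T (b i) := fun i hi => by rw [hb]; exact hrep i (by omega)
  have hmid : |b 0 - v n| ≤ 1 := by rw [hb]; exact hlazy n (by omega)
  rw [abs_le] at hmid
  suffices h0 : v 0 = b 0 by
    intro i hi
    rw [← hb]
    exact lazy_walks_eq_of_start_eq hpf la lb hT h0 i (by omega)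
  by_contra hne
  obtain H | H := lazy_walks_sub_const_or_add_const hpf la lb hT
  · have key (x : ℤ) (hx : v 0 ≤ x ∧ x ≤ v n ∨ v n ≤ x ∧ x ≤ v 0) :
        T x = T (x + (b 0 - v 0)) := by
      obtain ⟨i, hi, rfl⟩ := exists_le_eq_of_lazy_of_mem_uIcc la hx
      rw [hT i hi]
      congr 1
      have := H i hi
      omega
    obtain hlt | hlt := lt_or_gt_of_ne hne
    · exact hnr.not_forall_eq (p := v 0) (q := v n) (c := b 0 - v 0) (by omega) (by omega)
        fun x h1 h2 => key x (by omega)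
    · refine hnr.not_forall_eq (p := v n + (b 0 - v 0)) (q := b 0) (c := v 0 - b 0)
        (by omega) (by omega) fun x h1 h2 => ?_
      rw [key (x + (v 0 - b 0)) (by omega)]
      congr 1
      omega
  · have key (x : ℤ) (hx : v 0 ≤ x ∧ x ≤ v n ∨ v n ≤ x ∧ x ≤ v 0) :
        T x = T (b 0 + v 0 - x) := by
      obtain ⟨i, hi, rfl⟩ := exists_le_eq_of_lazy_of_mem_uIcc la hx
      rw [hT i hi]
      congr 1
      have := H i hi
      omega
    obtain ⟨p, q, hpq, hc, hx⟩ : ∃ p q, p < q ∧ p + q = b 0 + v 0 ∧ ∀ x, p ≤ x → x ≤ q →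
        ((v 0 ≤ x ∧ x ≤ v n ∨ v n ≤ x ∧ x ≤ v 0) ∨
          (v 0 ≤ p + q - x ∧ p + q - x ≤ v n ∨ v n ≤ p + q - x ∧ p + q - x ≤ v 0)) := by
      obtain hle | hle := le_total (v 0) (b 0)
      · exact ⟨v 0, b 0, by omega, by omega, fun x _ _ => by omega⟩
      · exact ⟨b 0, v 0, by omega, by omega, fun x _ _ => by omega⟩
    refine hpf.not_forall_eq hpq fun x h1 h2 => ?_
    rw [hc] at hx ⊢
    obtain h | h := hx x h1 h2
    · exact key x h
    · rw [key _ h, sub_sub_cancel]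
end

section
/- Let n ≥ 1 and let T₁, …, Tₙ : ℤ → Fin 4 each be nonrepetitive and palindrome-free sequences. Color ℤⁿ by the product coloring c(x₁,…,xₙ) = (T₁(x₁), …, Tₙ(xₙ)). If v₁, …, v_k, v_{k+1}, …, v_{2k} (k ≥ 1) is a lazy walk in ℤⁿ (i.e. each coordinate of v_{i+1} − v_i lies in {−1,0,1} for all 1 ≤ i < 2k) satisfying c(v_i) = c(v_{k+i}) for all 1 ≤ i ≤ k, then v_i = v_{k+i} for all 1 ≤ i ≤ k. -/
/-- In a nonrepetitive sequence, consecutive terms differ. -/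
theorem Nonrepetitive.ne_add_one {S : Type*} {T : ℤ → S} (hT : Nonrepetitive T) (x : ℤ) :
    T x ≠ T (x + 1) := by
  refine fun h => hT ⟨x, 1, le_rfl, fun t ht => ?_⟩
  obtain rfl : t = 0 := by omega
  simpa using h

/-- In a palindrome-free sequence, the two neighbours of a position have different terms. -/
theorem PalindromeFree.ne_neighbors {S : Type*} {T : ℤ → S} (hT : PalindromeFree T) (x : ℤ) :
    T (x - 1) ≠ T (x + 1) := by
  refine fun h => hT ⟨x - 1, x + 1, by omega, fun t ht ht' => ?_⟩
  obtain rfl | rfl | rfl : t = 0 ∨ t = 1 ∨ t = 2 := by omega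
  · simpa using h
  · congr 1
    ring
  · rw [show x - 1 + 2 = x + 1 by ring, show x + 1 - 2 = x - 1 by ring, h]

/-- A lazy walk on `ℤ` takes every value between its first and last one on the way up. -/
theorem exists_eq_of_lazy_up {f : ℕ → ℤ} {k : ℕ} (hf : ∀ i < k, |f (i + 1) - f i| ≤ 1) {m : ℤ}
    (h₀ : f 0 ≤ m) (h₁ : m < f k) : ∃ i < k, f i = m := by
  induction k with
  | zero => omega
  | succ k ih =>
    by_cases h : m < f k
    · obtain ⟨i, hi, rfl⟩ := ih (fun i hi => hf i (by omega)) h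
      exact ⟨i, by omega, rfl⟩
    · have := abs_le.1 (hf k (by omega))
      exact ⟨k, by omega, by omega⟩

/-- A lazy walk on `ℤ` takes every value between its first and last one on the way down. -/
theorem exists_eq_of_lazy_down {f : ℕ → ℤ} {k : ℕ} (hf : ∀ i < k, |f (i + 1) - f i| ≤ 1) {m : ℤ}
    (h₀ : m ≤ f 0) (h₁ : f k < m) : ∃ i < k, f i = m := by
  obtain ⟨i, hi, h⟩ := exists_eq_of_lazy_up (f := fun i => -f i) (k := k) (m := -m)
    (fun i hi => by
      have := abs_le.1 (hf i hi)
      exact abs_le.2 ⟨by omega, by omega⟩) (by omega) (by omega)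
  exact ⟨i, hi, by omega⟩

/-- The positions `x` and `y` have neighbours of the same colour in directions that agree if
`ε = 1` and are opposite if `ε = -1`. -/
def NeighborsMatch {S : Type*} (T : ℤ → S) (ε x y : ℤ) : Prop :=
  T (x + 1) = T (y + ε) ∨ T (x - 1) = T (y - ε)

theorem Int.eq_or_eq_add_one_or_eq_sub_one {x y : ℤ} (h : |y - x| ≤ 1) :
    y = x ∨ y = x + 1 ∨ y = x - 1 := by
  have := abs_le.1 h
  omega

/-- Once the relative orientation `ε` of two equally coloured walks is known, it determines the
next step of one walk from that of the other, and it persists. -/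
theorem NeighborsMatch.step {S : Type*} {T : ℤ → S} (hnr : Nonrepetitive T)
    (hpf : PalindromeFree T) {ε x y x' y' : ℤ} (hε : ε = 1 ∨ ε = -1)
    (h : NeighborsMatch T ε x y) (hx : |x' - x| ≤ 1) (hy : |y' - y| ≤ 1) (hxy : T x = T y)
    (hxy' : T x' = T y') : y' - y = ε * (x' - x) ∧ NeighborsMatch T ε x' y' := by
  unfold NeighborsMatch at *
  have h1 := hnr.ne_add_one x
  have h2 := hnr.ne_add_one (x - 1)
  have h3 := hpf.ne_neighbors x
  have h4 := hnr.ne_add_one y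
  have h5 := hnr.ne_add_one (y - 1)
  have h6 := hpf.ne_neighbors y
  rw [sub_add_cancel] at h2 h5
  obtain rfl | rfl := hε <;>
  obtain rfl | rfl | rfl := Int.eq_or_eq_add_one_or_eq_sub_one hx <;>
  obtain rfl | rfl | rfl := Int.eq_or_eq_add_one_or_eq_sub_one hy <;>
  try simp only [sub_neg_eq_add, ← sub_eq_add_neg, sub_add_cancel, add_sub_cancel_right] at h ⊢
  all_goals grind

/-- When one of two equally coloured walks stays in place, so does the other; otherwise they
acquire a relative orientation. -/
theorem NeighborsMatch.of_step {S : Type*} {T : ℤ → S} (hnr : Nonrepetitive T)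
    {x y x' y' : ℤ} (hx : |x' - x| ≤ 1) (hy : |y' - y| ≤ 1) (hxy : T x = T y)
    (hxy' : T x' = T y') : (x' = x ∧ y' = y) ∨
      ∃ ε, (ε = 1 ∨ ε = -1) ∧ NeighborsMatch T ε x' y' ∧ y' - y = ε * (x' - x) := by
  unfold NeighborsMatch
  have h1 := hnr.ne_add_one x
  have h2 := hnr.ne_add_one (x - 1)
  have h4 := hnr.ne_add_one y
  have h5 := hnr.ne_add_one (y - 1)
  rw [sub_add_cancel] at h2 h5
  obtain rfl | rfl | rfl := Int.eq_or_eq_add_one_or_eq_sub_one hx <;>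
  obtain rfl | rfl | rfl := Int.eq_or_eq_add_one_or_eq_sub_one hy
  · simp
  · grind
  · grind
  · grind
  · exact .inr ⟨1, by simp [hxy]⟩
  · exact .inr ⟨-1, by simp [hxy]⟩
  · grind
  · exact .inr ⟨-1, by simp [hxy]⟩
  · exact .inr ⟨1, by simp [hxy]⟩

/-- Two equally coloured lazy walks on `ℤ` are translates or reflections of one another. -/
theorem exists_orientation {S : Type*} {T : ℤ → S} (hnr : Nonrepetitive T)
    (hpf : PalindromeFree T) {f g : ℕ → ℤ} {k : ℕ} (hf : ∀ i < k, |f (i + 1) - f i| ≤ 1)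
    (hg : ∀ i < k, |g (i + 1) - g i| ≤ 1) (h : ∀ i ≤ k, T (f i) = T (g i)) :
    ∃ ε : ℤ, (ε = 1 ∨ ε = -1) ∧ ∀ i ≤ k, g i - g 0 = ε * (f i - f 0) := by
  suffices H : (∀ i ≤ k, f i = f 0 ∧ g i = g 0) ∨ ∃ ε : ℤ, (ε = 1 ∨ ε = -1) ∧
      NeighborsMatch T ε (f k) (g k) ∧ ∀ i ≤ k, g i - g 0 = ε * (f i - f 0) by
    obtain H | ⟨ε, hε, -, H⟩ := H
    · exact ⟨1, .inl rfl, fun i hi => by simp [H i hi]⟩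
    · exact ⟨ε, hε, H⟩
  induction k with
  | zero => exact .inl fun i hi => by simp [Nat.le_zero.1 hi]
  | succ k ih =>
    have hfk := hf k (by omega)
    have hgk := hg k (by omega)
    have hk := h k (by omega)
    have hk' := h (k + 1) le_rfl
    obtain H | ⟨ε, hε, hm, H⟩ := ih (fun i hi => hf i (by omega)) (fun i hi => hg i (by omega))
      (fun i hi => h i (by omega))
    · obtain ⟨hfk0, hgk0⟩ := H k le_rfl
      obtain ⟨h1, h2⟩ | ⟨ε, hε, hm, h1⟩ := NeighborsMatch.of_step hnr hfk hgk hk hk'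
      · refine .inl fun i hi => ?_
        obtain hi | rfl := Nat.le_succ_iff.1 hi
        · exact H i hi
        · exact ⟨h1.trans hfk0, h2.trans hgk0⟩
      · refine .inr ⟨ε, hε, hm, fun i hi => ?_⟩
        obtain hi | rfl := Nat.le_succ_iff.1 hi
        · simp [H i hi]
        · rw [← hfk0, ← hgk0, h1]
    · obtain ⟨h1, hm'⟩ := hm.step hnr hpf hε hfk hgk hk hk'
      refine .inr ⟨ε, hε, hm', fun i hi => ?_⟩
      obtain hi | rfl := Nat.le_succ_iff.1 hi
      · exact H i hi
      · linear_combination h1 + H k le_rfl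

/-- A repetitive lazy walk on `ℤ` consists of two identical lazy walks. -/
theorem eq_of_repetitive_lazy_walk {S : Type*} {T : ℤ → S} (hnr : Nonrepetitive T)
    (hpf : PalindromeFree T) {f : ℕ → ℤ} {k : ℕ}
    (hf : ∀ i : ℕ, i + 1 < 2 * k → |f (i + 1) - f i| ≤ 1)
    (h : ∀ i < k, T (f i) = T (f (k + i))) : ∀ i < k, f i = f (k + i) := by
  intro i₀ hi₀
  obtain ⟨ε, hε, H⟩ := exists_orientation hnr hpf (f := f) (g := fun i => f (k + i)) (k := k - 1)
    (fun i hi => hf i (by omega)) (fun i hi => hf (k + i) (by omega))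
    (fun i hi => h i (by omega))
  replace H : ∀ i < k, f (k + i) - f k = ε * (f i - f 0) := fun i hi => H i (by omega)
  have hfk : ∀ i < k, |f (i + 1) - f i| ≤ 1 := fun i hi => hf i (by omega)
  obtain rfl | rfl := hε
  · suffices f k = f 0 by linarith [H i₀ hi₀]
    by_contra hne
    obtain hlt | hlt := lt_or_gt_of_ne hne
    · refine hnr ⟨2 * f k - f 0 + 1, (f 0 - f k).toNat, by omega, fun t ht => ?_⟩
      obtain ⟨i, hi, hfi⟩ := exists_eq_of_lazy_down hfk (m := f k + 1 + t) (by omega) (by omega)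
      have := H i hi
      convert (h i hi).symm using 2 <;> omega
    · refine hnr ⟨f 0, (f k - f 0).toNat, by omega, fun t ht => ?_⟩
      obtain ⟨i, hi, hfi⟩ := exists_eq_of_lazy_up hfk (m := f 0 + t) (by omega) (by omega)
      have := H i hi
      convert h i hi using 2 <;> omega
  · have hk0 : T (f 0) = T (f k) := h 0 (by omega)
    obtain hlt | heq | hlt := lt_trichotomy (f k) (f 0)
    · refine (hpf ⟨f k, f 0, hlt, fun t ht ht' => ?_⟩).elim
      obtain rfl | ht := ht.eq_or_lt
      · simpa using hk0.symm
      · obtain ⟨i, hi, hfi⟩ := exists_eq_of_lazy_down hfk (m := f k + t) (by omega) (by omega)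
        have := H i hi
        convert h i hi using 2 <;> omega
    · suffices hconst : ∀ i < k, f i = f 0 by
        have := H i₀ hi₀
        have := hconst i₀ hi₀
        omega
      intro i hi
      induction i with
      | zero => rfl
      | succ i ih =>
        have h1 := ih (by omega)
        have h2 := H (i + 1) hi
        have h3 := h (i + 1) hi
        have h4 := hpf.ne_neighbors (f 0)
        obtain h5 | h5 | h5 := Int.eq_or_eq_add_one_or_eq_sub_one (hfk i (by omega))
        · omega
        · rw [h5, show f (k + (i + 1)) = f 0 - 1 by omega, h1] at h3
          exact (h4 h3.symm).elim
        · rw [h5, show f (k + (i + 1)) = f 0 + 1 by omega, h1] at h3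
          exact (h4 h3).elim
    · refine (hpf ⟨f 0, f k, hlt, fun t ht ht' => ?_⟩).elim
      obtain rfl | ht' := ht'.eq_or_lt
      · simpa using hk0.symm
      · obtain ⟨i, hi, hfi⟩ := exists_eq_of_lazy_up hfk (m := f 0 + t) (by omega) (by omega)
        have := H i hi
        convert h i hi using 2 <;> omega

/-- **Theorem 3.** For the product coloring of `ℤⁿ` by `n` nonrepetitive,
palindrome-free sequences, any repetitive lazy walk is composed of two
identical lazy walks. The walk is `v 0, v 1, …, v (2k-1)`. -/
theorem repetitive_lazy_walk_product_coloring
    (n : ℕ) (hn : 1 ≤ n) (T : Fin n → ℤ → Fin 4)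
    (hnr : ∀ j, Nonrepetitive (T j)) (hpf : ∀ j, PalindromeFree (T j))
    (k : ℕ) (hk : 1 ≤ k) (v : ℕ → Fin n → ℤ)
    (hlazy : ∀ i : ℕ, i + 1 < 2 * k → ∀ j : Fin n, |v (i + 1) j - v i j| ≤ 1)
    (hrep : ∀ i < k, ∀ j : Fin n, T j (v i j) = T j (v (k + i) j)) :
    ∀ i < k, v i = v (k + i) := by
  intro i hi
  funext j
  exact eq_of_repetitive_lazy_walk (hnr j) (hpf j) (f := fun i => v i j)
    (fun i hi => hlazy i hi j) (fun i hi => hrep i hi j) i hi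
end

section
/- For every ε > 0 there exists N such that for all n ≥ N, the Cartesian product K_{n,n} □ K_{n,n} admits a nonrepetitive coloring using at most (3/2 + ε)·n² colors; that is, π(K_{n,n} □ K_{n,n}) ≤ (3/2 + o(1))·n² as n → ∞. -/
/-- A coloring `c` of a graph `G` is nonrepetitive if `G` contains no path
`v 0, …, v (2k-1)` (vertices pairwise distinct, consecutive vertices adjacent)
with `c (v i) = c (v (k+i))` for all `i < k`. -/
def NonrepColoring {V α : Type*} (G : SimpleGraph V) (c : V → α) : Prop :=
  ∀ k : ℕ, 1 ≤ k → ∀ v : ℕ → V,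
    Set.InjOn v (Set.Iio (2 * k)) →
    (∀ i : ℕ, i + 1 < 2 * k → G.Adj (v i) (v (i + 1))) →
    ¬ ∀ i < k, c (v i) = c (v (k + i))

/-- A proper coloring in which every edge is determined, up to one endpoint, by the ordered pair
of colors of its ends is nonrepetitive. -/
theorem NonrepColoring.of_adj {V α : Type*} {G : SimpleGraph V} {c : V → α}
    (hproper : ∀ p q, G.Adj p q → c p ≠ c q)
    (hpair : ∀ p q p' q', G.Adj p q → G.Adj p' q' → c p = c p' → c q = c q' → p = p' ∨ q = q') :
    NonrepColoring G c := by
  intro k hk v hinj hadj hrep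
  obtain rfl | hk2 := hk.eq_or_lt
  · exact hproper _ _ (hadj 0 (by omega)) (hrep 0 (by omega))
  · rcases hpair _ _ _ _ (hadj 0 (by omega)) (hadj k (by omega)) (hrep 0 (by omega))
      (hrep 1 (by omega)) with h | h
    · have := hinj (Set.mem_Iio.2 (by omega)) (Set.mem_Iio.2 (by omega)) h
      omega
    · have := hinj (Set.mem_Iio.2 (by omega)) (Set.mem_Iio.2 (by omega)) h
      omega

/-- The coloring of `K_{n,n} □ K_{n,n}` that is injective on the first block, a Latin square on
the opposite block, and on each of the two other blocks records the coordinate shared with the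
neighbors in the Latin square block. -/
def latinBlockColoring {R : Type*} [Add R] :
    (R ⊕ R) × (R ⊕ R) → (R × R) ⊕ (R ⊕ (R ⊕ R))
  | (.inl i, .inl j) => .inl (i, j)
  | (.inl _, .inr j) => .inr (.inl j)
  | (.inr i, .inl _) => .inr (.inr (.inl i))
  | (.inr i, .inr j) => .inr (.inr (.inr (i + j)))

theorem latinBlockColoring_ne_of_adj {R : Type*} [Add R] (p q : (R ⊕ R) × (R ⊕ R))
    (h : ((completeBipartiteGraph R R).boxProd (completeBipartiteGraph R R)).Adj p q) :
    latinBlockColoring p ≠ latinBlockColoring q := by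
  rcases p with ⟨a | a, b | b⟩ <;> rcases q with ⟨a' | a', b' | b'⟩ <;>
    simp_all [latinBlockColoring, SimpleGraph.boxProd_adj]

theorem latinBlockColoring_eq_or_eq_of_adj {R : Type*} [Add R] [IsCancelAdd R]
    (p q p' q' : (R ⊕ R) × (R ⊕ R))
    (h : ((completeBipartiteGraph R R).boxProd (completeBipartiteGraph R R)).Adj p q)
    (h' : ((completeBipartiteGraph R R).boxProd (completeBipartiteGraph R R)).Adj p' q')
    (hp : latinBlockColoring p = latinBlockColoring p')
    (hq : latinBlockColoring q = latinBlockColoring q') : p = p' ∨ q = q' := by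
  rcases p with ⟨a | a, b | b⟩ <;> rcases p' with ⟨a' | a', b' | b'⟩ <;>
    simp only [latinBlockColoring, Sum.inl.injEq, Sum.inr.injEq, reduceCtorEq, Prod.mk.injEq]
      at hp <;>
    rcases q with ⟨d | d, e | e⟩ <;> rcases q' with ⟨d' | d', e' | e'⟩ <;>
    simp_all [latinBlockColoring, SimpleGraph.boxProd_adj]

/-- **Theorem 7.** `π(K_{n,n} □ K_{n,n}) ≤ (3/2 + o(1))·n²` as `n → ∞`: for every
`ε > 0` there is `N` such that for all `n ≥ N`, the Cartesian (box) product of two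
complete bipartite graphs `K_{n,n}` has a nonrepetitive coloring with at most
`(3/2 + ε)·n²` colors. -/
theorem completeBipartite_box_nonrepetitive_asymptotic :
    ∀ ε : ℝ, 0 < ε → ∃ N : ℕ, ∀ n : ℕ, N ≤ n →
      ∃ m : ℕ, (m : ℝ) ≤ (3 / 2 + ε) * (n : ℝ) ^ 2 ∧
        ∃ c : (Fin n ⊕ Fin n) × (Fin n ⊕ Fin n) → Fin m,
          NonrepColoring
            ((completeBipartiteGraph (Fin n) (Fin n)).boxProd
              (completeBipartiteGraph (Fin n) (Fin n))) c := by
  intro ε hε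
  refine ⟨6, fun n hn => ⟨Fintype.card ((Fin n × Fin n) ⊕ (Fin n ⊕ (Fin n ⊕ Fin n))), ?_, ?_⟩⟩
  · have hn' : (6 : ℝ) ≤ n := by exact_mod_cast hn
    simp only [Fintype.card_sum, Fintype.card_prod, Fintype.card_fin]
    push_cast
    nlinarith [mul_nonneg hε.le (sq_nonneg (n : ℝ))]
  · have : NeZero n := ⟨by omega⟩
    refine ⟨Fintype.equivFin _ ∘ latinBlockColoring, .of_adj ?_ ?_⟩
    · intro p q h e
      exact latinBlockColoring_ne_of_adj p q h ((Fintype.equivFin _).injective e)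
    · intro p q p' q' h h' hp hq
      exact latinBlockColoring_eq_or_eq_of_adj p q p' q' h h' ((Fintype.equivFin _).injective hp)
        ((Fintype.equivFin _).injective hq)
end

section
/- There exists a sequence T : ℤ → Fin 3 that is nonrepetitive, i.e. there exist no i ∈ ℤ and k ≥ 1 such that T(i+t) = T(i+k+t) for all 0 ≤ t < k. (Thue's theorem for the two-way infinite path: π(P) = 3, upper bound.) -/
/-- Two-way infinite Thue–Morse sequences with values in `{0, 1}`: the usual sequence on the
nonnegative integers, extended to the left by its reflection (`c = 0`) or by the complement of
its reflection (`c = 1`). The two are images of each other under `0 ↦ 01`, `1 ↦ 10`. -/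
def twoSidedThueMorse (c : Fin 2) (n : ℤ) : ℤ :=
  if n = 0 then 0
  else if n = -1 then c.val
  else if n % 2 = 0 then twoSidedThueMorse (1 - c) (n / 2)
  else 1 - twoSidedThueMorse (1 - c) (n / 2)
termination_by n.natAbs
decreasing_by all_goals omega

theorem twoSidedThueMorse_two_mul (c : Fin 2) (n : ℤ) :
    twoSidedThueMorse c (2 * n) = twoSidedThueMorse (1 - c) n := by
  by_cases hn : n = 0
  · subst hn
    simp [twoSidedThueMorse]
  · rw [twoSidedThueMorse, if_neg (by omega), if_neg (by omega), if_pos (by omega)]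
    congr 1
    omega

theorem twoSidedThueMorse_two_mul_add_one (c : Fin 2) (n : ℤ) :
    twoSidedThueMorse c (2 * n + 1) = 1 - twoSidedThueMorse (1 - c) n := by
  by_cases hn : n = -1
  · subst hn
    fin_cases c <;> simp [twoSidedThueMorse]
  · rw [twoSidedThueMorse, if_neg (by omega), if_neg (by omega), if_neg (by omega)]
    congr 2
    omega

theorem twoSidedThueMorse_eq_zero_or_one (c : Fin 2) (n : ℤ) :
    twoSidedThueMorse c n = 0 ∨ twoSidedThueMorse c n = 1 := by
  fun_induction twoSidedThueMorse c n <;> omega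

theorem twoSidedThueMorse_add_one_of_even (c : Fin 2) {n : ℤ} (hn : n % 2 = 0) :
    twoSidedThueMorse c (n + 1) = 1 - twoSidedThueMorse c n := by
  obtain ⟨m, rfl⟩ : ∃ m, n = 2 * m := ⟨n / 2, by omega⟩
  rw [twoSidedThueMorse_two_mul, twoSidedThueMorse_two_mul_add_one]

/-- The two-sided Thue–Morse sequences are overlap-free. -/
theorem twoSidedThueMorse_overlapFree (c : Fin 2) (i : ℤ) (k : ℕ) (hk : 1 ≤ k) :
    ¬ ∀ t : ℕ, t ≤ k → twoSidedThueMorse c (i + t) = twoSidedThueMorse c (i + k + t) := by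
  induction k using Nat.strong_induction_on generalizing c i with
  | _ k ih =>
  intro h
  obtain ⟨m, rfl | rfl⟩ : ∃ m, k = 2 * m ∨ k = 2 * m + 1 := ⟨k / 2, by omega⟩
  · refine ih m (by omega) (1 - c) (i / 2) (by omega) fun s hs => ?_
    have h2 := h (2 * s) (by omega)
    rcases Int.emod_two_eq_zero_or_one i with hi | hi
    · rw [← twoSidedThueMorse_two_mul, ← twoSidedThueMorse_two_mul]
      convert h2 using 2 <;> push_cast <;> omega
    · have h3 : 1 - twoSidedThueMorse (1 - c) (i / 2 + s)
          = 1 - twoSidedThueMorse (1 - c) (i / 2 + m + s) := by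
        rw [← twoSidedThueMorse_two_mul_add_one, ← twoSidedThueMorse_two_mul_add_one]
        convert h2 using 2 <;> push_cast <;> omega
      omega
  · have alternating : ∀ t : ℕ, t < 2 * m + 1 →
        twoSidedThueMorse c (i + (t + 1 : ℕ)) = 1 - twoSidedThueMorse c (i + t) := by
      intro t ht
      rcases Int.emod_two_eq_zero_or_one (i + t) with hi | hi
      · rw [← twoSidedThueMorse_add_one_of_even c hi]
        push_cast
        ring_nf
      · rw [h t ht.le, h (t + 1) ht, ← twoSidedThueMorse_add_one_of_even c (by omega)]
        push_cast
        ring_nf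
    have parity : ∀ s : ℕ, s ≤ m →
        twoSidedThueMorse c (i + (2 * s : ℕ)) = twoSidedThueMorse c i := by
      intro s hs
      induction s with
      | zero => simp
      | succ s ihs =>
        have h1 := alternating (2 * s) (by omega)
        have h2 := alternating (2 * s + 1) (by omega)
        have h3 := ihs (by omega)
        rw [show 2 * (s + 1) = 2 * s + 1 + 1 by ring]
        omega
    have h1 := parity m le_rfl
    have h2 := alternating (2 * m) (by omega)
    have h3 := h 0 (by omega)
    simp only [Nat.cast_zero, add_zero] at h3
    omega

/-- **Thue's theorem** for the two-way infinite path: there exists a nonrepetitive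
sequence `T : ℤ → Fin 3` (so `π(P) ≤ 3`). -/
theorem exists_nonrepetitive_three_coloring :
    ∃ T : ℤ → Fin 3, Nonrepetitive T := by
  set u := twoSidedThueMorse 0 with hu
  have u_values : ∀ n, u n = 0 ∨ u n = 1 := twoSidedThueMorse_eq_zero_or_one 0
  refine ⟨fun n => if u (n + 1) = u n then 0 else if u n = 0 then 1 else 2, ?_⟩
  rintro ⟨i, k, hk, h⟩
  have difference : ∀ t : ℕ, t ≤ k → u (i + t) - u i = u (i + k + t) - u (i + k) := by
    intro t ht
    induction t with
    | zero => simp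
    | succ t iht =>
      have h1 := iht (by omega)
      have h2 := h t ht
      have a := u_values (i + t)
      have b := u_values (i + t + 1)
      have c := u_values (i + k + t)
      have d := u_values (i + k + t + 1)
      push_cast
      rw [← add_assoc, ← add_assoc]
      dsimp only at h2
      split_ifs at h2 <;> omega
  have h1 := difference k le_rfl
  have a := u_values i
  have b := u_values (i + k)
  have c := u_values (i + k + k)
  refine twoSidedThueMorse_overlapFree 0 i k hk fun t ht => ?_
  have h2 := difference t ht
  rw [← hu]
  omega
end

section
/- There exists a sequence T* : ℤ → Fin 4 that is both nonrepetitive and palindrome-free; that is, there exist no i ∈ ℤ and k ≥ 1 with T*(i+t) = T*(i+k+t) for all 0 ≤ t < k, and there exist no integers i < j with T*(i+t) = T*(j−t) for all 0 ≤ t ≤ j−i. -/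
/-- The Thue–Morse sequence: `thueMorse n` is the parity of the binary digit sum of `n`. -/
def thueMorse : ℕ → Bool
  | 0 => false
  | n + 1 => xor (decide ((n + 1) % 2 = 1)) (thueMorse ((n + 1) / 2))

theorem thueMorse_eq (n : ℕ) : thueMorse n = xor (decide (n % 2 = 1)) (thueMorse (n / 2)) := by
  cases n with
  | zero => simp [thueMorse]
  | succ n => rw [thueMorse]

theorem thueMorse_two_mul (n : ℕ) : thueMorse (2 * n) = thueMorse n := by
  rw [thueMorse_eq (2 * n)]
  simp

theorem thueMorse_two_mul_add_one (n : ℕ) : thueMorse (2 * n + 1) = !thueMorse n := by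
  rw [thueMorse_eq (2 * n + 1), show (2 * n + 1) / 2 = n by omega]
  simp [Nat.add_mod]

theorem thueMorse_succ_ne_of_even {n : ℕ} (hn : n % 2 = 0) :
    thueMorse (n + 1) = !thueMorse n := by
  obtain ⟨m, rfl⟩ : ∃ m, n = 2 * m := ⟨n / 2, by omega⟩
  rw [thueMorse_two_mul_add_one, thueMorse_two_mul]

/-- The Thue–Morse sequence is overlap-free. -/
theorem thueMorse_overlapFree (k : ℕ) (hk : 1 ≤ k) (i : ℕ)
    (h : ∀ j ≤ k, thueMorse (i + j) = thueMorse (i + k + j)) : False := by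
  induction k using Nat.strong_induction_on generalizing i with
  | _ k ih =>
    rcases Nat.even_or_odd' k with ⟨m, rfl | rfl⟩
    · refine ih m (by omega) (by omega) (i / 2) fun j hj => ?_
      have hj' := h (2 * j) (by omega)
      rcases Nat.even_or_odd' i with ⟨p, rfl | rfl⟩
      · rw [show 2 * p + 2 * j = 2 * (p + j) by ring,
          show 2 * p + 2 * m + 2 * j = 2 * (p + m + j) by ring,
          thueMorse_two_mul, thueMorse_two_mul] at hj'
        rwa [show 2 * p / 2 = p by omega]
      · rw [show 2 * p + 1 + 2 * j = 2 * (p + j) + 1 by ring,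
          show 2 * p + 1 + 2 * m + 2 * j = 2 * (p + m + j) + 1 by ring,
          thueMorse_two_mul_add_one, thueMorse_two_mul_add_one] at hj'
        rw [show (2 * p + 1) / 2 = p by omega]
        simpa using hj'
    · have alternating : ∀ j < 2 * m + 1, thueMorse (i + j + 1) = !thueMorse (i + j) := by
        intro j hj
        rcases Nat.mod_two_eq_zero_or_one (i + j) with hp | hp
        · exact thueMorse_succ_ne_of_even hp
        · have h₁ := h j hj.le
          have h₂ := h (j + 1) hj
          have h₃ := thueMorse_succ_ne_of_even (n := i + (2 * m + 1) + j) (by omega)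
          rw [← add_assoc, ← add_assoc] at h₂
          rw [h₂, h₁, h₃]
      have even_shift : ∀ j ≤ m, thueMorse (i + 2 * j) = thueMorse i := by
        intro j
        induction j with
        | zero => simp
        | succ j hj =>
          intro hle
          have h₁ := alternating (2 * j) (by omega)
          have h₂ := alternating (2 * j + 1) (by omega)
          rw [← add_assoc, h₁, hj (by omega)] at h₂
          simpa [mul_add, ← add_assoc] using h₂
      have h₀ := h 0 (by omega)
      have h₁ := alternating (2 * m) (by omega)
      rw [even_shift m le_rfl] at h₁
      rw [add_zero, add_zero, ← add_assoc, h₁] at h₀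
      simp at h₀

/-- The ternary Thue sequence, recording the steps of the Thue–Morse sequence. -/
def ternaryThue (n : ℕ) : Fin 4 :=
  if thueMorse (n + 1) = thueMorse n then 0 else if thueMorse n then 1 else 2

theorem ternaryThue_ne_three (n : ℕ) : ternaryThue n ≠ 3 := by
  unfold ternaryThue
  split_ifs <;> decide

theorem thueMorse_succ_eq_of_ternaryThue_eq {m n : ℕ} (h : ternaryThue m = ternaryThue n)
    (hmn : thueMorse m = thueMorse n) : thueMorse (m + 1) = thueMorse (n + 1) := by
  unfold ternaryThue at h
  generalize thueMorse (m + 1) = a, thueMorse (n + 1) = b, thueMorse m = c,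
    thueMorse n = d at *
  revert a b c d
  decide

theorem thueMorse_succ_eq_self_of_ternaryThue_eq {m n : ℕ} (h : ternaryThue m = ternaryThue n)
    (hmn : thueMorse m ≠ thueMorse n) :
    thueMorse (m + 1) = thueMorse m ∧ thueMorse (n + 1) = thueMorse n := by
  unfold ternaryThue at h
  generalize thueMorse (m + 1) = a, thueMorse (n + 1) = b, thueMorse m = c,
    thueMorse n = d at *
  revert a b c d
  decide

theorem ternaryThue_squareFree (i k : ℕ) (hk : 1 ≤ k)
    (h : ∀ j < k, ternaryThue (i + j) = ternaryThue (i + k + j)) : False := by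
  by_cases h₀ : thueMorse i = thueMorse (i + k)
  · refine thueMorse_overlapFree k hk i fun j => ?_
    induction j with
    | zero => simpa using h₀
    | succ j ih =>
      intro hj
      exact thueMorse_succ_eq_of_ternaryThue_eq (h j hj) (ih (by omega))
  · have const : ∀ j ≤ k, thueMorse (i + j) = thueMorse i ∧
        thueMorse (i + k + j) = thueMorse (i + k) := by
      intro j
      induction j with
      | zero => simp
      | succ j ih =>
        intro hj
        obtain ⟨h₁, h₂⟩ := ih (by omega)
        obtain ⟨h₃, h₄⟩ := thueMorse_succ_eq_self_of_ternaryThue_eq (h j hj)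
          (by rwa [h₁, h₂])
        exact ⟨h₃.trans h₁, h₄.trans h₂⟩
    exact h₀ (const k le_rfl).1.symm

theorem ternaryThue_succ_ne (n : ℕ) : ternaryThue n ≠ ternaryThue (n + 1) := fun h =>
  ternaryThue_squareFree n 1 le_rfl fun j hj => by simpa [Nat.lt_one_iff.mp hj] using h

/-- The ternary Thue sequence with a fourth letter inserted after every second letter. -/
def quaternaryThue (n : ℕ) : Fin 4 :=
  if n % 3 = 2 then 3 else ternaryThue (2 * (n / 3) + n % 3)

theorem quaternaryThue_eq_three_iff {n : ℕ} : quaternaryThue n = 3 ↔ n % 3 = 2 := by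
  unfold quaternaryThue
  split_ifs with h <;> simp [h, ternaryThue_ne_three]

/-- The position in `quaternaryThue` of the `n`-th letter of `ternaryThue`. -/
theorem quaternaryThue_embed (n : ℕ) :
    quaternaryThue (3 * (n / 2) + n % 2) = ternaryThue n := by
  unfold quaternaryThue
  rw [if_neg (by omega)]
  congr 1
  omega

theorem quaternaryThue_succ_ne (n : ℕ) : quaternaryThue n ≠ quaternaryThue (n + 1) := by
  intro h
  have h₁ := quaternaryThue_eq_three_iff (n := n)
  have h₂ := quaternaryThue_eq_three_iff (n := n + 1)
  rw [h] at h₁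
  have h₃ : n % 3 = 0 := by
    have := h₁.symm.trans h₂
    omega
  refine ternaryThue_succ_ne (2 * (n / 3)) ?_
  rw [← quaternaryThue_embed, ← quaternaryThue_embed]
  convert h using 2 <;> omega

theorem quaternaryThue_add_two_ne (n : ℕ) : quaternaryThue n ≠ quaternaryThue (n + 2) := by
  intro h
  have h₁ := quaternaryThue_eq_three_iff (n := n)
  have h₂ := quaternaryThue_eq_three_iff (n := n + 2)
  rw [h] at h₁
  have h₃ : n % 3 = 1 := by
    have := h₁.symm.trans h₂
    omega
  refine ternaryThue_succ_ne (2 * (n / 3) + 1) ?_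
  rw [← quaternaryThue_embed, ← quaternaryThue_embed]
  convert h using 2 <;> omega

theorem quaternaryThue_squareFree (i k : ℕ) (hk : 1 ≤ k)
    (h : ∀ j < k, quaternaryThue (i + j) = quaternaryThue (i + k + j)) : False := by
  have h₀ := h 0 (by omega)
  rw [add_zero, add_zero] at h₀
  have hk₁ : k ≠ 1 := by
    rintro rfl
    exact quaternaryThue_succ_ne i h₀
  have hk₂ : k ≠ 2 := by
    rintro rfl
    exact quaternaryThue_add_two_ne i h₀
  have period : k % 3 = 0 := by
    have h₁ := h ((5 - i % 3) % 3) (by omega)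
    rw [quaternaryThue_eq_three_iff.mpr (by omega)] at h₁
    have := quaternaryThue_eq_three_iff.mp h₁.symm
    omega
  obtain ⟨m, rfl⟩ : ∃ m, k = 3 * m := ⟨k / 3, by omega⟩
  refine ternaryThue_squareFree (2 * (i / 3) + i % 3) (2 * m) (by omega) fun j hj => ?_
  set n := 2 * (i / 3) + i % 3 + j with hn
  have hs := h (3 * (n / 2) + n % 2 - i) (by omega)
  rw [← quaternaryThue_embed, ← quaternaryThue_embed]
  convert hs using 2 <;> omega

/-- Every sequence over a finite alphabet has a bi-infinite sequence all of whose factors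
are among its factors. -/
theorem exists_biinfinite_of_factors {S : Type*} [Finite S] (f : ℕ → S) :
    ∃ T : ℤ → S, ∀ (i : ℤ) (L : ℕ), ∃ m : ℕ, ∀ t < L, T (i + (t : ℕ)) = f (m + t) := by
  have limit (i : ℤ) : ∃ v : S, ∀ᶠ n : ℕ in (Filter.hyperfilter ℕ : Filter ℕ),
      f (i + n).toNat = v := by
    exact Ultrafilter.eventually_exists_iff.mp (Filter.Eventually.of_forall fun n => ⟨_, rfl⟩)
  choose T hT using limit
  refine ⟨T, fun i L => ?_⟩
  have window : ∀ᶠ n : ℕ in (Filter.hyperfilter ℕ : Filter ℕ),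
      ∀ t ∈ Finset.range L, f (i + t + n).toNat = T (i + t) :=
    (Filter.eventually_all_finset _).mpr fun t _ => hT (i + t)
  have large : ∀ᶠ n : ℕ in (Filter.hyperfilter ℕ : Filter ℕ), i.natAbs ≤ n :=
    Nat.hyperfilter_le_atTop (Filter.eventually_ge_atTop _)
  obtain ⟨n, hn, hi⟩ := (window.and large).exists
  refine ⟨(i + n).toNat, fun t ht => ?_⟩
  rw [← hn t (Finset.mem_range.mpr ht)]
  congr 1
  omega

/-- There exists a palindrome-free Thue sequence: a sequence `T* : ℤ → Fin 4`
that is both nonrepetitive and palindrome-free. -/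
theorem exists_palindromeFree_thue_sequence :
    ∃ T : ℤ → Fin 4, Nonrepetitive T ∧ PalindromeFree T := by
  obtain ⟨T, hT⟩ := exists_biinfinite_of_factors quaternaryThue
  have hT₁ (i : ℤ) : T i ≠ T (i + 1) := by
    obtain ⟨m, hm⟩ := hT i 2
    have h₀ := hm 0 (by omega)
    have h₁ := hm 1 (by omega)
    simp only [Nat.cast_zero, Nat.cast_one, add_zero] at h₀ h₁
    rw [h₀, h₁]
    exact quaternaryThue_succ_ne m
  have hT₂ (i : ℤ) : T i ≠ T (i + 2) := by
    obtain ⟨m, hm⟩ := hT i 3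
    have h₀ := hm 0 (by omega)
    have h₂ := hm 2 (by omega)
    simp only [Nat.cast_zero, Nat.cast_ofNat, add_zero] at h₀ h₂
    rw [h₀, h₂]
    exact quaternaryThue_add_two_ne m
  refine ⟨T, ?_, ?_⟩
  · rintro ⟨i, k, hk, h⟩
    obtain ⟨m, hm⟩ := hT i (2 * k)
    refine quaternaryThue_squareFree m k hk fun j hj => ?_
    rw [← hm j (by omega), add_assoc, ← hm (k + j) (by omega), h j hj]
    push_cast
    rw [add_assoc]
  · rintro ⟨i, j, hij, h⟩
    rcases Int.even_or_odd' (j - i) with ⟨c, hc | hc⟩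
    · have hp := h (c - 1) (by omega) (by omega)
      rw [show j - (c - 1) = i + (c - 1) + 2 by omega] at hp
      exact hT₂ _ hp
    · have hp := h c (by omega) (by omega)
      rw [show j - c = i + c + 1 by omega] at hp
      exact hT₁ _ hp
end

section
/- Let T : ℤ → Fin 3 be a nonrepetitive sequence, and define T* : ℤ → Fin 4 by T*(n) = 3 (a new fourth symbol) if 3 divides n, and T*(n) = T(n − ⌊n/3⌋) otherwise (with ⌊·⌋ denoting floor division of integers). Then T* is nonrepetitive and palindrome-free. -/
theorem insert_symbol_eq_iff (T : ℤ → Fin 3) (a b : ℤ) :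
    ((if (3 : ℤ) ∣ a then (3 : Fin 4) else (T (a - Int.fdiv a 3)).castSucc) =
      if (3 : ℤ) ∣ b then (3 : Fin 4) else (T (b - Int.fdiv b 3)).castSucc) ↔
    (3 ∣ a ∧ 3 ∣ b) ∨ (¬ 3 ∣ a ∧ ¬ 3 ∣ b ∧ T (a - a / 3) = T (b - b / 3)) := by
  have last_ne (x : Fin 3) : x.castSucc ≠ (3 : Fin 4) := Fin.castSucc_ne_last x
  have fdiv_eq (n : ℤ) : Int.fdiv n 3 = n / 3 :=
    Int.fdiv_eq_ediv_of_nonneg n (by norm_num)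
  rw [fdiv_eq, fdiv_eq]
  by_cases ha : (3 : ℤ) ∣ a <;> by_cases hb : (3 : ℤ) ∣ b <;>
    simp [ha, hb, last_ne, (last_ne _).symm]

theorem Nonrepetitive.apply_ne_apply_add_one {S : Type*} {T : ℤ → S}
    (hT : Nonrepetitive T) (j : ℤ) : T j ≠ T (j + 1) := by
  intro h
  refine hT ⟨j, 1, le_rfl, fun t ht => ?_⟩
  obtain rfl : t = 0 := by omega
  simpa using h

theorem insert_symbol_ne_of_lt_of_le_add_two {T : ℤ → Fin 3} (hT : Nonrepetitive T)
    {a b : ℤ} (hab : a < b) (hba : b ≤ a + 2) :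
    (if (3 : ℤ) ∣ a then (3 : Fin 4) else (T (a - Int.fdiv a 3)).castSucc) ≠
      if (3 : ℤ) ∣ b then (3 : Fin 4) else (T (b - Int.fdiv b 3)).castSucc := by
  rw [Ne, insert_symbol_eq_iff]
  rintro (⟨ha, hb⟩ | ⟨ha, hb, h⟩)
  · omega
  · rw [show b - b / 3 = a - a / 3 + 1 by omega] at h
    exact hT.apply_ne_apply_add_one _ h

/-- Inserting a new fourth symbol at the multiples of `3` into a nonrepetitive
sequence `T : ℤ → Fin 3` yields a sequence `T* : ℤ → Fin 4` (where `Fin 3` is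
embedded into `Fin 4` via `Fin.castSucc` and `⌊n/3⌋ = Int.fdiv n 3`) that is
nonrepetitive and palindrome-free. -/
theorem insert_symbol_nonrepetitive_palindromeFree
    (T : ℤ → Fin 3) (hT : Nonrepetitive T) :
    Nonrepetitive (fun n : ℤ =>
        if (3 : ℤ) ∣ n then (3 : Fin 4) else (T (n - Int.fdiv n 3)).castSucc) ∧
    PalindromeFree (fun n : ℤ =>
        if (3 : ℤ) ∣ n then (3 : Fin 4) else (T (n - Int.fdiv n 3)).castSucc) := by
 
  constructor
  · rintro ⟨i, k, hk, h⟩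
    by_cases hk2 : k ≤ 2
    · exact insert_symbol_ne_of_lt_of_le_add_two hT (by omega) (by omega) (h 0 (by omega))
    have h' : ∀ n : ℤ, i ≤ n → n < i + k → (3 ∣ n ∧ 3 ∣ n + k) ∨
        (¬ 3 ∣ n ∧ ¬ 3 ∣ n + k ∧ T (n - n / 3) = T (n + k - (n + k) / 3)) := by
      intro n hn hnk
      have := (insert_symbol_eq_iff T _ _).1 (h (n - i).toNat (by omega))
      rwa [show i + ((n - i).toNat : ℤ) = n by omega,
        show i + k + ((n - i).toNat : ℤ) = n + k by omega] at this
    obtain ⟨m, hm⟩ : ∃ m : ℕ, k = 3 * m := by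
      have := h' (3 * ((i + 2) / 3)) (by omega) (by omega)
      exact ⟨k / 3, by omega⟩
    obtain ⟨i', hi', hi'0⟩ : ∃ i' : ℤ, (i' = i ∨ 3 ∣ i ∧ i' = i + 1) ∧ ¬ 3 ∣ i' := by
      by_cases hi : (3 : ℤ) ∣ i
      · exact ⟨i + 1, by omega, by omega⟩
      · exact ⟨i, by omega, hi⟩
    refine hT ⟨i' - i' / 3, 2 * m, by omega, fun t ht => ?_⟩
    obtain ⟨n, hn⟩ : ∃ n : ℤ, n = i' - i' / 3 + t + (i' - i' / 3 + t - 1) / 2 := ⟨_, rfl⟩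
    have key := h' n (by omega) (by omega)
    rcases key with ⟨hd, -⟩ | ⟨-, -, hn'⟩
    · omega
    · rw [show n - n / 3 = i' - i' / 3 + t by omega,
        show n + k - (n + k) / 3 = i' - i' / 3 + (2 * m : ℕ) + t by omega] at hn'
      exact hn'
  · rintro ⟨i, j, hij, h⟩
    have h' := h ((j - i - 1) / 2) (by omega) (by omega)
    exact insert_symbol_ne_of_lt_of_le_add_two hT (by omega) (by omega) h'
end
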